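/- arXiv:1901.05847 — 3 statements merged into one kernel-verified Lean document; each statement's English description precedes it below -/
import Mathlib

section
/- Let Ω be a nonempty finite set and let l, u : Ω → ℝ satisfy 0 ≤ l(ω) ≤ u(ω) ≤ 1 for all ω ∈ Ω. Assume ∑_{ω∈Ω} l(ω) ≤ 1 ≤ ∑_{ω∈Ω} u(ω), and assume that for every ω ∈ Ω, l(ω) + ∑_{j∈Ω, j≠ω} u(j) ≥ 1. Then for every ω ∈ Ω there exists p in the credal set K = {p : Ω → ℝ | ∀ω', l(ω') ≤ p(ω') ≤ u(ω'), and ∑_{ω'∈Ω} p(ω') = 1} with p(ω) = l(ω); that is, every lower bound is reachable. -/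
/-- Every value between the sums of two pointwise ordered functions is the sum of a function
lying between them. -/
theorem exists_between_sum_eq {ι : Type*} [Fintype ι] {l v : ι → ℝ} {c : ℝ}
    (hlv : ∀ i, l i ≤ v i) (hl : ∑ i, l i ≤ c) (hv : c ≤ ∑ i, v i) :
    ∃ p : ι → ℝ, (∀ i, l i ≤ p i ∧ p i ≤ v i) ∧ ∑ i, p i = c := by
  have hcont : ContinuousOn (fun t : ℝ => ∑ i, (l i + t * (v i - l i))) (Set.Icc 0 1) := by
    fun_prop
  obtain ⟨t, ⟨ht0, ht1⟩, ht⟩ := intermediate_value_Icc zero_le_one hcont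
    (show c ∈ Set.Icc _ _ by constructor <;> simpa)
  refine ⟨fun i => l i + t * (v i - l i), fun i => ?_, ht⟩
  constructor <;> nlinarith [hlv i]

/-- Under conditions (2) and the first half of (3), every lower bound is reachable
by some distribution in the credal set. -/
theorem lower_bound_reachable {Ω : Type*} [Fintype Ω] [Nonempty Ω] [DecidableEq Ω]
    (l u : Ω → ℝ)
    (hbounds : ∀ ω, 0 ≤ l ω ∧ l ω ≤ u ω ∧ u ω ≤ 1)
    (hsum : ∑ ω, l ω ≤ 1 ∧ 1 ≤ ∑ ω, u ω)
    (h3 : ∀ ω : Ω, 1 ≤ l ω + ∑ j ∈ Finset.univ.erase ω, u j) :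
    ∀ ω : Ω, ∃ p ∈ {p : Ω → ℝ | (∀ ω', l ω' ≤ p ω' ∧ p ω' ≤ u ω') ∧ ∑ ω', p ω' = 1},
      p ω = l ω := by
  intro ω
  have hle : ∀ i, l i ≤ Function.update u ω (l ω) i := by
    intro i
    rcases eq_or_ne i ω with rfl | hi
    · simp
    · simpa [hi] using (hbounds i).2.1
  have hupper : 1 ≤ ∑ i, Function.update u ω (l ω) i := by
    rw [Finset.sum_update_of_mem (Finset.mem_univ ω), Finset.sdiff_singleton_eq_erase]
    exact h3 ω
  obtain ⟨p, hp, hp1⟩ := exists_between_sum_eq hle hsum.1 hupper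
  refine ⟨p, ⟨fun i => ⟨(hp i).1, ?_⟩, hp1⟩, le_antisymm ?_ (hp ω).1⟩
  · rcases eq_or_ne i ω with rfl | hi
    · exact (by simpa using (hp i).2 : p i ≤ l i).trans (hbounds i).2.1
    · simpa [hi] using (hp i).2
  · simpa using (hp ω).2
end

section
/- Let Ω be a nonempty finite set, let l, u : Ω → ℝ satisfy 0 ≤ l(ω) ≤ u(ω) ≤ 1 for all ω ∈ Ω, and let K = {p : Ω → ℝ | ∀ω, l(ω) ≤ p(ω) ≤ u(ω), and ∑_{ω∈Ω} p(ω) = 1} be nonempty. If p is an extreme point of K, then there is at most one ω ∈ Ω with l(ω) < p(ω) < u(ω); that is, p attains either the lower or the upper bound on all but at most one coordinate. -/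
/-- An extreme point of the credal set of an interval-based probability distribution
attains either the lower or the upper interval bound on all but at most one coordinate. -/
theorem extremePoint_strict_coords_subsingleton {Ω : Type*} [Fintype Ω] [Nonempty Ω]
    (l u : Ω → ℝ)
    (hbounds : ∀ ω, 0 ≤ l ω ∧ l ω ≤ u ω ∧ u ω ≤ 1)
    (hne : {p : Ω → ℝ | (∀ ω, l ω ≤ p ω ∧ p ω ≤ u ω) ∧ ∑ ω, p ω = 1}.Nonempty)
    (p : Ω → ℝ)
    (hp : p ∈ Set.extremePoints ℝ
      {p : Ω → ℝ | (∀ ω, l ω ≤ p ω ∧ p ω ≤ u ω) ∧ ∑ ω, p ω = 1}) :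
    {ω : Ω | l ω < p ω ∧ p ω < u ω}.Subsingleton := by
  classical
  intro a ha b hb
  by_contra hab
  obtain ⟨hla, hua⟩ := ha
  obtain ⟨hlb, hub⟩ := hb
  obtain ⟨ε, hε, hε_le⟩ : ∃ ε > 0, ε ≤ min (min (p a - l a) (u a - p a))
      (min (p b - l b) (u b - p b)) :=
    ⟨_, by simp [hla, hua, hlb, hub], le_rfl⟩
  simp only [le_min_iff] at hε_le
  obtain ⟨⟨h1, h2⟩, h3, h4⟩ := hε_le
  have mem : ∀ e : ℝ, -ε ≤ e → e ≤ ε → p + (Pi.single a e - Pi.single b e) ∈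
      {p : Ω → ℝ | (∀ ω, l ω ≤ p ω ∧ p ω ≤ u ω) ∧ ∑ ω, p ω = 1} := by
    intro e he he'
    refine ⟨fun ω => ?_, ?_⟩
    · by_cases hωa : ω = a
      · subst hωa
        simp only [Pi.add_apply, Pi.sub_apply, Pi.single_eq_same, Pi.single_eq_of_ne hab]
        constructor <;> linarith
      · by_cases hωb : ω = b
        · subst hωb
          simp only [Pi.add_apply, Pi.sub_apply, Pi.single_eq_same, Pi.single_eq_of_ne hωa]
          constructor <;> linarith
        · simpa [hωa, hωb] using hp.1.1 ω
    · simp [Finset.sum_add_distrib, Finset.sum_sub_distrib, hp.1.2]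
  have hseg : p ∈ openSegment ℝ (p + (Pi.single a ε - Pi.single b ε))
      (p + (Pi.single a (-ε) - Pi.single b (-ε))) := by
    refine ⟨1 / 2, 1 / 2, by norm_num, by norm_num, by norm_num, ?_⟩
    simp only [Pi.single_neg]
    module
  have heq := congrFun (hp.2 (mem ε (by linarith) le_rfl)
    (mem (-ε) le_rfl (by linarith)) hseg) a
  simp [hab] at heq
  linarith
end

section
/- Let Ω be a nonempty finite set of cardinality N, let l, u : Ω → ℝ satisfy 0 ≤ l(ω) ≤ u(ω) ≤ 1 for all ω ∈ Ω, and let K = {p : Ω → ℝ | ∀ω, l(ω) ≤ p(ω) ≤ u(ω), and ∑_{ω∈Ω} p(ω) = 1}. Then the set of extreme points of K is finite and has cardinality at most N! (N factorial). -/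
/-- At an extreme point of a box cut by a hyperplane `∑ i, p i = c`, at most one coordinate is
off both of its bounds. -/
theorem eq_of_mem_extremePoints_of_ne_bounds {Ω : Type*} [Fintype Ω] {l u p : Ω → ℝ} {c : ℝ}
    (hp : p ∈ Set.extremePoints ℝ
      {p : Ω → ℝ | (∀ ω, l ω ≤ p ω ∧ p ω ≤ u ω) ∧ ∑ ω, p ω = c})
    {i j : Ω} (hil : p i ≠ l i) (hiu : p i ≠ u i) (hjl : p j ≠ l j) (hju : p j ≠ u j) :
    i = j := by
  classical
  by_contra hij
  obtain ⟨⟨hb, hs⟩, hext⟩ := hp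
  have hli := lt_of_le_of_ne (hb i).1 hil.symm
  have hui := lt_of_le_of_ne (hb i).2 hiu
  have hlj := lt_of_le_of_ne (hb j).1 hjl.symm
  have huj := lt_of_le_of_ne (hb j).2 hju
  obtain ⟨ε, hε, hε'⟩ : ∃ ε > 0, ε < min (min (p i - l i) (u i - p i))
      (min (p j - l j) (u j - p j)) :=
    exists_between (by simp [hli, hui, hlj, huj])
  simp only [lt_min_iff] at hε'
  obtain ⟨⟨h₁, h₂⟩, h₃, h₄⟩ := hε'
  have mem : ∀ t : ℝ, |t| ≤ ε → p + (Pi.single i t - Pi.single j t) ∈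
      {p : Ω → ℝ | (∀ ω, l ω ≤ p ω ∧ p ω ≤ u ω) ∧ ∑ ω, p ω = c} := by
    intro t ht
    obtain ⟨ht₁, ht₂⟩ := abs_le.mp ht
    refine ⟨fun ω => ?_, by simp [Finset.sum_add_distrib, hs]⟩
    have := hb ω
    by_cases hωi : ω = i
    · subst hωi
      simp only [Pi.add_apply, Pi.sub_apply, Pi.single_eq_same, Pi.single_eq_of_ne hij]
      constructor <;> linarith
    · by_cases hωj : ω = j
      · subst hωj
        simp only [Pi.add_apply, Pi.sub_apply, Pi.single_eq_same, Pi.single_eq_of_ne hωi]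
        constructor <;> linarith
      · simpa [hωi, hωj] using this
  have key := hext (mem ε (abs_of_pos hε).le) (mem (-ε) (by rw [abs_neg, abs_of_pos hε]))
    ⟨1 / 2, 1 / 2, by norm_num, by norm_num, by norm_num, by
      ext ω
      simp only [Pi.single_neg, Pi.add_apply, Pi.sub_apply, Pi.smul_apply, Pi.neg_apply,
        smul_eq_mul]
      ring⟩
  have := congrFun key i
  simp [hij] at this
  exact hε.ne' this

/-- Two points of a box with the same coordinate sum are equal if, along a common linear order
of the coordinates, both first attain upper bounds and then, after at most one exception,
lower bounds. -/
theorem eq_of_forall_lt_eq_upper_or_eq_lower {ι : Type*} [Fintype ι] [LinearOrder ι]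
    {l u p q : ι → ℝ} (hp : ∀ i, l i ≤ p i ∧ p i ≤ u i) (hq : ∀ i, l i ≤ q i ∧ q i ≤ u i)
    (hsum : ∑ i, p i = ∑ i, q i)
    (hp' : ∀ i j, i < j → p i = u i ∨ p j = l j)
    (hq' : ∀ i j, i < j → q i = u i ∨ q j = l j) : p = q := by
  have hle : p ≤ q ∨ q ≤ p := by
    by_contra! h
    simp only [Pi.le_def, not_forall, not_le] at h
    obtain ⟨⟨j, hj⟩, i, hi⟩ := h
    rcases lt_trichotomy i j with hij | rfl | hij
    · rcases hp' i j hij with h | h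
      · linarith [(hq i).2]
      · linarith [(hq j).1]
    · linarith
    · rcases hq' j i hij with h | h
      · linarith [(hp j).2]
      · linarith [(hp i).1]
  rcases hle with h | h
  · exact funext fun i => (Finset.sum_eq_sum_iff_of_le fun i _ => h i).mp hsum i (Finset.mem_univ i)
  · exact funext fun i =>
      ((Finset.sum_eq_sum_iff_of_le fun i _ => h i).mp hsum.symm i (Finset.mem_univ i)).symm

open Classical in
/-- The rank of a coordinate of a point of a box: `0` at the upper bound, `2` at the lower bound
only, and `1` at neither. -/
noncomputable def boundRank {Ω : Type*} (l u p : Ω → ℝ) (ω : Ω) : ℕ :=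
  if p ω = u ω then 0 else if p ω = l ω then 2 else 1

/-- Sorting the coordinates of an extreme point by rank lists those at their upper bound, then
at most one other, then those at their lower bound. -/
theorem eq_upper_or_eq_lower_of_lt_of_mem_extremePoints {Ω : Type*} [Fintype Ω] {n : ℕ}
    (e : Fin n ≃ Ω) {l u p : Ω → ℝ} {c : ℝ}
    (hp : p ∈ Set.extremePoints ℝ
      {p : Ω → ℝ | (∀ ω, l ω ≤ p ω ∧ p ω ≤ u ω) ∧ ∑ ω, p ω = c})
    {i j : Fin n} (hij : i < j) :
    p (e (Tuple.sort (boundRank l u p ∘ e) i)) = u (e (Tuple.sort (boundRank l u p ∘ e) i)) ∨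
    p (e (Tuple.sort (boundRank l u p ∘ e) j)) = l (e (Tuple.sort (boundRank l u p ∘ e) j)) := by
  have hmono := Tuple.monotone_sort (boundRank l u p ∘ e) hij.le
  have hne : e (Tuple.sort (boundRank l u p ∘ e) i) ≠ e (Tuple.sort (boundRank l u p ∘ e) j) :=
    fun h => hij.ne (by simpa using h)
  simp only [Function.comp_apply] at hmono
  generalize e (Tuple.sort (boundRank l u p ∘ e) i) = a at *
  generalize e (Tuple.sort (boundRank l u p ∘ e) j) = b at *
  by_contra! h
  have hpair := fun h₁ h₂ => hne (eq_of_mem_extremePoints_of_ne_bounds hp h₁ h.1 h.2 h₂)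
  unfold boundRank at hmono
  split_ifs at hmono <;> simp_all

/-- The credal set of an interval-based probability distribution over a set of
cardinality `N` has finitely many extreme points, at most `N!` of them. -/
theorem extremePoints_card_le_factorial {Ω : Type*} [Fintype Ω] [Nonempty Ω]
    (l u : Ω → ℝ)
    (hbounds : ∀ ω, 0 ≤ l ω ∧ l ω ≤ u ω ∧ u ω ≤ 1) :
    (Set.extremePoints ℝ
        {p : Ω → ℝ | (∀ ω, l ω ≤ p ω ∧ p ω ≤ u ω) ∧ ∑ ω, p ω = 1}).Finite ∧
    Nat.card (Set.extremePoints ℝ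
        {p : Ω → ℝ | (∀ ω, l ω ≤ p ω ∧ p ω ≤ u ω) ∧ ∑ ω, p ω = 1}) ≤
      Nat.factorial (Fintype.card Ω) := by
  let e := (Fintype.equivFin Ω).symm
  let f (p : Set.extremePoints ℝ
      {p : Ω → ℝ | (∀ ω, l ω ≤ p ω ∧ p ω ≤ u ω) ∧ ∑ ω, p ω = 1}) :
      Equiv.Perm (Fin (Fintype.card Ω)) := Tuple.sort (boundRank l u p.1 ∘ e)
  have hf : Function.Injective f := by
    rintro ⟨p, hp⟩ ⟨q, hq⟩ hpq
    let s : Fin (Fintype.card Ω) ≃ Ω := (f ⟨p, hp⟩).trans e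
    have hs : s = (f ⟨q, hq⟩).trans e := by rw [← hpq]
    have hcomp : p ∘ s = q ∘ s := by
      refine eq_of_forall_lt_eq_upper_or_eq_lower (l := l ∘ s) (u := u ∘ s)
        (fun i => hp.1.1 (s i)) (fun i => hq.1.1 (s i)) ?_
        (fun i j hij => eq_upper_or_eq_lower_of_lt_of_mem_extremePoints e hp hij) ?_
      · simp only [Function.comp_apply, Equiv.sum_comp s, hp.1.2, hq.1.2]
      · rw [hs]
        exact fun i j hij => eq_upper_or_eq_lower_of_lt_of_mem_extremePoints e hq hij
    exact Subtype.ext (s.surjective.injective_comp_right hcomp)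
  refine ⟨Set.finite_coe_iff.mp (Finite.of_injective f hf), ?_⟩
  simpa [Nat.card_eq_fintype_card, Fintype.card_perm] using Nat.card_le_card_of_injective f hf
end
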